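/- If k and ℓ are positive integers with v₂(k) = v₂(ℓ), where v₂ denotes the 2-adic valuation (the exponent of the largest power of 2 dividing the number), then the punctured interval tile k(1)ℓ tiles ℤ^3. -/

import Mathlib

/-- The one-dimensional tile `k(m)ℓ`: an interval of length `k`, a gap of
length `m`, and an interval of length `ℓ`. -/
def punctTile (k m l : ℕ) : Set ℤ :=
  {x : ℤ | (0 ≤ x ∧ x < (k : ℤ)) ∨ ((k : ℤ) + m ≤ x ∧ x < (k : ℤ) + m + l)}

/-- `P` is a copy of the one-dimensional tile `T` in `ℤ^d`: the image of `T`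
under `x ↦ v + x • e i` or `x ↦ v - x • e i` for some axis `i` and `v ∈ ℤ^d`. -/
def IsCopy (d : ℕ) (T : Set ℤ) (P : Set (Fin d → ℤ)) : Prop :=
  ∃ (v : Fin d → ℤ) (i : Fin d) (ε : ℤ), (ε = 1 ∨ ε = -1) ∧
    P = (fun x : ℤ => fun j : Fin d => v j + if j = i then ε * x else 0) '' T

/-- The one-dimensional tile `T` tiles the subset `S ⊆ ℤ^d`. -/
def Tiles (d : ℕ) (T : Set ℤ) (S : Set (Fin d → ℤ)) : Prop :=
  ∃ F : Set (Set (Fin d → ℤ)),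
    (∀ P ∈ F, IsCopy d T P) ∧ F.Pairwise Disjoint ∧ ⋃₀ F = S

/-- The one-dimensional tile `T` tiles `ℤ^d`. -/
def TilesZd (d : ℕ) (T : Set ℤ) : Prop := Tiles d T Set.univ

/-- The interval `[c - a, c + b]` with the point `c` removed. -/
def puncturedAt (a b : ℕ) (c : ℤ) : Set ℤ :=
  {x | c - a ≤ x ∧ x ≤ c + b ∧ x ≠ c}

/-- `P` is a translate of `k(1)ℓ` or of its reflection `ℓ(1)k`. -/
def IsLineCopy (k l : ℕ) (P : Set ℤ) : Prop :=
  ∃ c, P = puncturedAt k l c ∨ P = puncturedAt l k c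

/-- `k(1)ℓ` tiles the subset `S` of the line. -/
def LineTiles (k l : ℕ) (S : Set ℤ) : Prop :=
  ∃ F : Set (Set ℤ), (∀ P ∈ F, IsLineCopy k l P) ∧ F.Pairwise Disjoint ∧ ⋃₀ F = S

lemma IsLineCopy.symm {k l : ℕ} {P : Set ℤ} (h : IsLineCopy k l P) : IsLineCopy l k P :=
  h.imp fun _ => Or.symm

lemma lineTiles_empty (k l : ℕ) : LineTiles k l ∅ :=
  ⟨∅, by simp, by simp, by simp⟩

lemma lineTiles_of_family {k l : ℕ} {S : Set ℤ} (J : Set ℤ) (P : ℤ → Set ℤ)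
    (hP : ∀ j, IsLineCopy k l (P j))
    (hdisj : ∀ i ∈ J, ∀ j ∈ J, ∀ x, x ∈ P i → x ∈ P j → i = j)
    (hS : ∀ x, x ∈ S ↔ ∃ j ∈ J, x ∈ P j) : LineTiles k l S := by
  refine ⟨P '' J, ?_, ?_, ?_⟩
  · rintro _ ⟨j, -, rfl⟩
    exact hP j
  · rintro _ ⟨i, hi, rfl⟩ _ ⟨j, hj, rfl⟩ hne
    exact Set.disjoint_left.2 fun x hxi hxj => hne (by rw [hdisj i hi j hj x hxi hxj])
  · ext x
    simp [hS]

/-- A copy of the tile on a line, placed on an axis-parallel line of `ℤ^d`. -/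
lemma IsLineCopy.isCopy_image_update {k l d : ℕ} {P : Set ℤ} (h : IsLineCopy k l P)
    (v : Fin d → ℤ) (i : Fin d) :
    IsCopy d (punctTile k 1 l) (Function.update v i '' P) := by
  obtain ⟨c, rfl | rfl⟩ := h
  · refine ⟨Function.update v i (c - k), i, 1, Or.inl rfl, ?_⟩
    have hP : puncturedAt k l c = (fun x : ℤ => c - k + 1 * x) '' punctTile k 1 l := by
      ext x
      simp only [puncturedAt, punctTile, Set.mem_ofPred_eq, Set.mem_image]
      constructor
      · intro hx
        exact ⟨x - (c - k), by push_cast; omega, by ring⟩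
      · rintro ⟨y, hy, rfl⟩
        push_cast at hy
        omega
    rw [hP, Set.image_image]
    refine Set.image_congr fun x _ => ?_
    ext j
    by_cases hj : j = i
    · subst hj; simp
    · simp [hj]
  · refine ⟨Function.update v i (c + k), i, -1, Or.inr rfl, ?_⟩
    have hP : puncturedAt l k c = (fun x : ℤ => c + k + (-1) * x) '' punctTile k 1 l := by
      ext x
      simp only [puncturedAt, punctTile, Set.mem_ofPred_eq, Set.mem_image]
      constructor
      · intro hx
        exact ⟨c + k - x, by push_cast; omega, by ring⟩
      · rintro ⟨y, hy, rfl⟩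
        push_cast at hy
        omega
    rw [hP, Set.image_image]
    refine Set.image_congr fun x _ => ?_
    ext j
    by_cases hj : j = i
    · subst hj; simp
    · simp [hj]

/-- If `ℤ^d` is partitioned into sets `G i` such that every line in direction `i` meets `G i` in
a tileable set, then `ℤ^d` can be tiled. -/
lemma tilesZd_of_slices {k l d : ℕ} (G : Fin d → Set (Fin d → ℤ))
    (hG : ∀ w, ∃! i, w ∈ G i)
    (hline : ∀ i v, LineTiles k l {n | Function.update v i n ∈ G i}) :
    TilesZd d (punctTile k 1 l) := by
  choose F hcopy hdisj hunion using hline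
  have hmem : ∀ {i v P n}, P ∈ F i v → n ∈ P → Function.update v i n ∈ G i := by
    intro i v P n hP hn
    have : n ∈ ⋃₀ F i v := ⟨P, hP, hn⟩
    rwa [hunion] at this
  refine ⟨{Q | ∃ i v, v i = 0 ∧ ∃ P ∈ F i v, Q = Function.update v i '' P}, ?_, ?_, ?_⟩
  · rintro _ ⟨i, v, -, P, hP, rfl⟩
    exact (hcopy i v P hP).isCopy_image_update v i
  · rintro _ ⟨i, v, hv, P, hP, rfl⟩ _ ⟨i', v', hv', P', hP', rfl⟩ hne
    refine Set.disjoint_left.2 ?_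
    rintro _ ⟨n, hn, rfl⟩ ⟨n', hn', heq⟩
    have hi : i = i' :=
      (hG (Function.update v i n)).unique (hmem hP hn) (heq ▸ hmem hP' hn')
    subst hi
    have hnn : n' = n := by simpa using congrFun heq i
    have hvv : v' = v := by
      ext j
      by_cases hj : j = i
      · rw [hj, hv, hv']
      · simpa [hj] using congrFun heq j
    subst hnn hvv
    refine hne ?_
    by_cases hPP : P = P'
    · rw [hPP]
    · exact absurd hn' (Set.disjoint_left.1 (hdisj i v' hP hP' hPP) hn)
  · refine Set.eq_univ_of_forall fun w => ?_
    obtain ⟨i, hi, -⟩ := hG w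
    have : w i ∈ ⋃₀ F i (Function.update w i 0) := by
      rw [hunion]
      simpa using hi
    obtain ⟨P, hP, hw⟩ := this
    exact ⟨_, ⟨i, Function.update w i 0, by simp, P, hP, rfl⟩, w i, hw, by simp⟩

/-- The complement of a residue class modulo `k + ℓ + 1` is tiled by `k(1)ℓ`. -/
lemma lineTiles_not_modEq (k l : ℕ) (c : ℤ) :
    LineTiles k l {y | ¬ y ≡ c [ZMOD k + l + 1]} := by
  have hpos : (0 : ℤ) < k + l + 1 := by positivity
  refine lineTiles_of_family {j | j ≡ c [ZMOD k + l + 1]} (puncturedAt k l)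
    (fun j => ⟨j, Or.inl rfl⟩) ?_ ?_
  · intro i hi j hj x hxi hxj
    obtain ⟨m, hm⟩ := (hi.trans hj.symm).dvd
    simp only [puncturedAt, Set.mem_ofPred_eq] at hxi hxj
    have h1 : m < 1 := by nlinarith
    have h2 : -1 < m := by nlinarith
    have : m = 0 := by omega
    subst this
    linarith
  · intro y
    constructor
    · intro hy
      have hr0 := Int.emod_nonneg (y - (c - k)) hpos.ne'
      have hr1 := Int.emod_lt_of_pos (y - (c - k)) hpos
      have hj : y - (y - (c - k)) % (k + l + 1) + k ≡ c [ZMOD k + l + 1] := by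
        refine (Int.modEq_iff_dvd.2 ⟨-((y - (c - k)) / (k + l + 1)), ?_⟩)
        linarith [Int.emod_add_mul_ediv (y - (c - k)) (k + l + 1)]
      refine ⟨_, hj, ?_, ?_, ?_⟩
      · linarith
      · linarith
      · intro h
        rw [← h] at hj
        exact hy hj
    · rintro ⟨j, hj, h1, h2, h3⟩ hy
      obtain ⟨m, hm⟩ := (hy.trans (Int.ModEq.symm hj)).dvd
      have h4 : m < 1 := by nlinarith
      have h5 : -1 < m := by nlinarith
      have : m = 0 := by omega
      subst this
      exact h3 (by linarith)

/-- Three parallel lines can be partially tiled so that at every height exactly one of them,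
the one with index congruent to `f z` modulo `3`, is left uncovered. -/
lemma exists_lineTiles_three (k l : ℕ) (hk : 0 < k) (hl : 0 < l) :
    ∃ f : ℤ → ℤ, ∀ i : ℤ, LineTiles k l {z | f z % 3 ≠ i % 3} := by
  set t : ℤ → ℤ := fun j => (j / 2) * (k + l) + if j % 2 = 0 then 0 else (k : ℤ) with ht
  have hstep : ∀ j, t (j + 1) = t j + if j % 2 = 0 then (k : ℤ) else l := by
    intro j
    rcases Int.emod_two_eq_zero_or_one j with h | h
    · have h1 : (j + 1) % 2 = 1 := by omega
      have h2 : (j + 1) / 2 = j / 2 := by omega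
      simp only [ht, h, h1, h2]
      norm_num
    · have h1 : (j + 1) % 2 = 0 := by omega
      have h2 : (j + 1) / 2 = j / 2 + 1 := by omega
      simp only [ht, h, h1, h2]
      norm_num
      ring
  have hmono : StrictMono t := by
    refine strictMono_int_of_lt_succ fun j => ?_
    rw [hstep]
    split_ifs <;> omega
  have hfloor : ∀ z, ∃ J, t J ≤ z ∧ z < t (J + 1) := by
    intro z
    have hpos : (0 : ℤ) < k + l := by positivity
    have h0 := Int.emod_nonneg z hpos.ne'
    have h1 := Int.emod_lt_of_pos z hpos
    have h2 := Int.emod_add_mul_ediv z (k + l)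
    have e0 : t (2 * (z / (k + l))) = (k + l) * (z / (k + l)) := by
      simp [ht, mul_comm]
    have e1 := hstep (2 * (z / (k + l)))
    have e2 := hstep (2 * (z / (k + l)) + 1)
    rw [if_pos (by omega)] at e1
    rw [if_neg (by omega)] at e2
    by_cases h : z % (k + l) < k
    · exact ⟨2 * (z / (k + l)), by linarith, by linarith⟩
    · exact ⟨2 * (z / (k + l)) + 1, by linarith, by linarith⟩
  choose J hJ hJ' using hfloor
  set U : ℤ → Set ℤ := fun j =>
    if j % 2 = 0 then puncturedAt l k (t j) else puncturedAt k l (t j) with hU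
  have hmemU : ∀ j z, z ∈ U j ↔ t (j - 1) ≤ z ∧ z ≤ t (j + 1) ∧ z ≠ t j := by
    intro j z
    have e0 := hstep j
    have e1 := hstep (j - 1)
    rw [sub_add_cancel] at e1
    simp only [hU]
    by_cases h : j % 2 = 0
    · rw [if_pos h] at e0 ⊢
      rw [if_neg (by omega)] at e1
      simp only [puncturedAt, Set.mem_ofPred_eq]
      omega
    · rw [if_neg h] at e0 ⊢
      rw [if_pos (by omega)] at e1
      simp only [puncturedAt, Set.mem_ofPred_eq]
      omega
  have hcover : ∀ j z, z ∈ U j ↔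
      if z = t (J z) then j = J z - 1 ∨ j = J z + 1 else j = J z ∨ j = J z + 1 := by
    intro j z
    rw [hmemU]
    have hz := hJ z
    have hz' := hJ' z
    generalize J z = m at hz hz'
    have a1 : t (j - 1) ≤ z ↔ j - 1 ≤ m := by
      refine ⟨fun h => ?_, fun h => (hmono.monotone h).trans hz⟩
      have := hmono.lt_iff_lt.1 (h.trans_lt hz')
      omega
    rw [a1]
    split_ifs with h
    · rw [h, hmono.le_iff_le, hmono.injective.ne_iff]
      omega
    · have a2 : z ≤ t (j + 1) ↔ m + 1 ≤ j + 1 := by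
        refine ⟨fun h' => ?_, fun h' => hz'.le.trans (hmono.monotone h')⟩
        have := hmono.lt_iff_lt.1 ((lt_of_le_of_ne hz (Ne.symm h)).trans_le h')
        omega
      have a3 : j = m ∨ j = m + 1 → z ≠ t j := by
        rintro (rfl | rfl)
        · exact h
        · exact hz'.ne
      rw [a2]
      constructor
      · rintro ⟨b1, b2, -⟩
        omega
      · intro b
        exact ⟨by omega, by omega, a3 b⟩
  refine ⟨fun z => if z = t (J z) then J z else J z + 2, fun i => ?_⟩
  refine lineTiles_of_family {j | j % 3 = i % 3} U ?_ ?_ ?_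
  · intro j
    simp only [hU]
    split_ifs
    · exact ⟨_, Or.inr rfl⟩
    · exact ⟨_, Or.inl rfl⟩
  · intro a ha b hb z hza hzb
    rw [hcover] at hza hzb
    simp only [Set.mem_ofPred_eq] at ha hb
    split_ifs at hza hzb <;> omega
  · intro z
    simp only [Set.mem_ofPred_eq, hcover]
    split_ifs with h
    · constructor
      · intro hz
        by_cases h' : (J z + 1) % 3 = i % 3
        · exact ⟨_, h', Or.inr rfl⟩
        · exact ⟨J z - 1, by omega, Or.inl rfl⟩
      · rintro ⟨j, hj, rfl | rfl⟩ <;> omega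
    · constructor
      · intro hz
        by_cases h' : (J z + 1) % 3 = i % 3
        · exact ⟨_, h', Or.inr rfl⟩
        · exact ⟨J z, by omega, Or.inl rfl⟩
      · rintro ⟨j, hj, rfl | rfl⟩ <;> omega

/-- There are pairs of copies `P c`, `P' c` of the tile, indexed by `c ∈ C`, whose symmetric
differences partition the line, such that pairs with congruent indices modulo `k + ℓ + 1` do not
meet. -/
def HasFlips (k l : ℕ) : Prop :=
  ∃ (C : Set ℤ) (P P' : ℤ → Set ℤ),
    (∀ c, IsLineCopy k l (P c)) ∧ (∀ c, IsLineCopy k l (P' c)) ∧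
    (∀ x, ∃! c, c ∈ C ∧ ¬(x ∈ P c ↔ x ∈ P' c)) ∧
    ∀ c ∈ C, ∀ c' ∈ C, c ≡ c' [ZMOD k + l + 1] →
      ∀ x, x ∈ P c ∪ P' c → x ∈ P c' ∪ P' c' → c = c'

lemma HasFlips.symm {k l : ℕ} (h : HasFlips k l) : HasFlips l k := by
  obtain ⟨C, P, P', hP, hP', hD, hsep⟩ := h
  refine ⟨C, P, P', fun c => (hP c).symm, fun c => (hP' c).symm, hD, ?_⟩
  rwa [add_comm (l : ℤ) k]

theorem HasFlips.tilesZd {k l : ℕ} (hk : 0 < k) (hl : 0 < l) (h : HasFlips k l) :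
    TilesZd 3 (punctTile k 1 l) := by
  obtain ⟨C, P, P', hP, hP', hD, hsep⟩ := h
  choose col hcol huniq using hD
  obtain ⟨f, hf⟩ := exists_lineTiles_three k l hk hl
  let row (Q : ℤ → Set ℤ) (y : ℤ) : Set ℤ :=
    {x | ∃ c ∈ {c | c ∈ C ∧ c ≡ y [ZMOD k + l + 1]}, x ∈ Q c}
  have hrow : ∀ Q : ℤ → Set ℤ, (∀ c, IsLineCopy k l (Q c)) → (∀ c, Q c ⊆ P c ∪ P' c) →
      ∀ y, LineTiles k l (row Q y) := fun Q hQ hsub y =>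
    lineTiles_of_family _ Q hQ (fun a ha b hb x hxa hxb =>
      hsep a ha.1 b hb.1 (ha.2.trans hb.2.symm) x (hsub a hxa) (hsub b hxb)) fun x => Iff.rfl
  have hrowP := hrow P hP fun c => Set.subset_union_left
  have hrowP' := hrow P' hP' fun c => Set.subset_union_right
  have hparity : ∀ x y, y ≡ col x [ZMOD k + l + 1] ↔ ¬(x ∈ row P y ↔ x ∈ row P' y) := by
    intro x y
    constructor
    · intro hy
      have key : ∀ Q : ℤ → Set ℤ, (∀ c, Q c ⊆ P c ∪ P' c) → x ∈ P (col x) ∪ P' (col x) →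
          (x ∈ row Q y ↔ x ∈ Q (col x)) := by
        refine fun Q hQ hx => ⟨?_, fun h => ⟨_, ⟨(hcol x).1, hy.symm⟩, h⟩⟩
        rintro ⟨c, ⟨hc, hcy⟩, hxc⟩
        rwa [hsep (col x) (hcol x).1 c hc (hcy.trans hy).symm x hx (hQ c hxc)]
      have hx : x ∈ P (col x) ∪ P' (col x) := by
        have := (hcol x).2
        simp only [Set.mem_union]
        tauto
      rw [key P (fun c => Set.subset_union_left) hx, key P' (fun c => Set.subset_union_right) hx]
      exact (hcol x).2
    · intro hne
      by_contra hy
      refine hne (exists_congr fun c => and_congr_right fun hc => ?_)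
      by_contra hx
      rw [huniq x c ⟨hc.1, hx⟩] at hc
      exact hy hc.2.symm
  refine tilesZd_of_slices (k := k) (l := l)
    ![{v | f (v 2) % 3 = 0 ∧ v 0 ∈ row P (v 1) ∨ f (v 2) % 3 = 1 ∧ v 0 ∈ row P' (v 1)},
      {v | f (v 2) % 3 = 2 ∧ ¬ v 1 ≡ col (v 0) [ZMOD k + l + 1]},
      {v | f (v 2) % 3 ≠ 0 ∧ v 0 ∈ row P (v 1) ∧ v 0 ∉ row P' (v 1) ∨
        f (v 2) % 3 ≠ 1 ∧ v 0 ∉ row P (v 1) ∧ v 0 ∈ row P' (v 1) ∨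
        f (v 2) % 3 ≠ 2 ∧ v 0 ∉ row P (v 1) ∧ v 0 ∉ row P' (v 1)}] ?_ ?_
  · intro v
    have h3 : f (v 2) % 3 = 0 ∨ f (v 2) % 3 = 1 ∨ f (v 2) % 3 = 2 := by omega
    have hp := hparity (v 0) (v 1)
    simp only [ExistsUnique, Fin.exists_fin_succ, Fin.forall_fin_succ]
    by_cases p : v 0 ∈ row P (v 1) <;> by_cases q : v 0 ∈ row P' (v 1) <;>
      rcases h3 with h | h | h <;> simp [p, q, h, hp, -EuclideanDomain.mod_eq_zero]
  · intro i v
    fin_cases i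
    · have h3 : f (v 2) % 3 = 0 ∨ f (v 2) % 3 = 1 ∨ f (v 2) % 3 = 2 := by omega
      rcases h3 with h | h | h
      · simpa [h, -EuclideanDomain.mod_eq_zero] using hrowP (v 1)
      · simpa [h, -EuclideanDomain.mod_eq_zero] using hrowP' (v 1)
      · simpa [h, -EuclideanDomain.mod_eq_zero] using lineTiles_empty k l
    · by_cases h : f (v 2) % 3 = 2
      · simpa [h, -EuclideanDomain.mod_eq_zero] using lineTiles_not_modEq k l (col (v 0))
      · simpa [h, -EuclideanDomain.mod_eq_zero] using lineTiles_empty k l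
    · by_cases p : v 0 ∈ row P (v 1) <;> by_cases q : v 0 ∈ row P' (v 1)
      · simpa [p, q] using lineTiles_empty k l
      · simpa [p, q] using hf 0
      · simpa [p, q] using hf 1
      · simpa [p, q] using hf 2

/-- The pairs `{c, c + d}` with `c / d` even partition the line. -/
lemma existsUnique_even_ediv {d : ℤ} (hd : 0 < d) (x : ℤ) :
    ∃! c, Even (c / d) ∧ (x = c ∨ x = c + d) := by
  have hsub : (x - d) / d = x / d - 1 := by
    have := Int.add_mul_ediv_right x (-1) hd.ne'
    rw [← sub_eq_add_neg] at this
    rw [← this]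
    ring_nf
  by_cases h : Even (x / d)
  · refine ⟨x, ⟨h, Or.inl rfl⟩, ?_⟩
    rintro c ⟨hc, rfl | rfl⟩
    · rfl
    · rw [add_sub_cancel_right] at hsub
      rw [hsub, Int.even_sub_one] at hc
      exact absurd h hc
  · refine ⟨x - d, ⟨?_, Or.inr (by ring)⟩, ?_⟩
    · rw [hsub, Int.even_sub_one]
      exact h
    · rintro c ⟨hc, rfl | rfl⟩
      · exact absurd hc h
      · ring

/-- If `k < ℓ`, then reversing a copy of `k(1)ℓ` in place changes it in two points. -/
lemma hasFlips_of_lt {k l : ℕ} (hkl : k < l) : HasFlips k l := by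
  refine ⟨{c | Even (c / ((l : ℤ) - k))}, puncturedAt k l, fun c => puncturedAt l k (c + (l - k)),
    fun c => ⟨c, Or.inl rfl⟩, fun c => ⟨_, Or.inr rfl⟩, fun x => ?_, ?_⟩
  · refine (existsUnique_congr fun c => and_congr_right fun _ => ?_).1
      (existsUnique_even_ediv (d := (l : ℤ) - k) (by omega) x)
    simp only [puncturedAt, Set.mem_ofPred_eq]
    omega
  · intro c _ c' _ hcc x hx hx'
    obtain ⟨m, hm⟩ := hcc.dvd
    simp only [puncturedAt, Set.mem_union, Set.mem_ofPred_eq] at hx hx'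
    have b1 : c - k ≤ x ∧ x ≤ c + l := by omega
    have b2 : c' - k ≤ x ∧ x ≤ c' + l := by omega
    have h1 : m < 1 := by nlinarith
    have h2 : -1 < m := by nlinarith
    have : m = 0 := by omega
    subst this
    linarith

/-- Shifting a copy of `k(1)k` by one changes it in the four points of a translate of
`{0, k} + {0, k + 1}`, and such sets with even translation partition the line. -/
lemma hasFlips_self {k : ℕ} (hk : 0 < k) : HasFlips k k := by
  obtain ⟨d, e, hd, hde, hpar⟩ : ∃ d e : ℤ, 0 < d ∧
      (d = k ∧ e = k + 1 ∨ d = k + 1 ∧ e = k) ∧ d % 2 = 0 := by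
    rcases Nat.mod_two_eq_zero_or_one k with h | h
    · exact ⟨k, k + 1, by omega, by omega, by omega⟩
    · exact ⟨k + 1, k, by omega, by omega, by omega⟩
  refine ⟨{c | c % 2 = 0 ∧ Even (c / d)}, fun c => puncturedAt k k (c + k),
    fun c => puncturedAt k k (c + k + 1),
    fun c => ⟨_, Or.inl rfl⟩, fun c => ⟨_, Or.inl rfl⟩, fun x => ?_, ?_⟩
  · have hflip : ∀ c, ¬(x ∈ puncturedAt k k (c + k) ↔ x ∈ puncturedAt k k (c + k + 1)) ↔
        x = c ∨ x = c + d ∨ x - e = c ∨ x - e = c + d := by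
      intro c
      simp only [puncturedAt, Set.mem_ofPred_eq]
      omega
    simp only [hflip, Set.mem_ofPred_eq]
    rcases Int.emod_two_eq_zero_or_one x with h | h
    · refine (existsUnique_congr fun c => ?_).1 (existsUnique_even_ediv hd x)
      constructor
      · rintro ⟨h1, h2⟩
        exact ⟨⟨by omega, h1⟩, by omega⟩
      · rintro ⟨⟨h0, h1⟩, h2⟩
        exact ⟨h1, by omega⟩
    · refine (existsUnique_congr fun c => ?_).1 (existsUnique_even_ediv hd (x - e))
      constructor
      · rintro ⟨h1, h2⟩
        exact ⟨⟨by omega, h1⟩, by omega⟩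
      · rintro ⟨⟨h0, h1⟩, h2⟩
        exact ⟨h1, by omega⟩
  · rintro c ⟨hc, -⟩ c' ⟨hc', -⟩ hcc x hx hx'
    obtain ⟨m, hm⟩ := hcc.dvd
    simp only [puncturedAt, Set.mem_union, Set.mem_ofPred_eq] at hx hx'
    have b1 : c ≤ x ∧ x ≤ c + 2 * k + 1 := by omega
    have b2 : c' ≤ x ∧ x ≤ c' + 2 * k + 1 := by omega
    have h1 : m < 2 := by nlinarith
    have h2 : -2 < m := by nlinarith
    obtain rfl | rfl | rfl : m = -1 ∨ m = 0 ∨ m = 1 := by omega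
    all_goals omega

/-- If `v₂(k) = v₂(ℓ)`, then `k(1)ℓ` tiles `ℤ^3`. -/
theorem equal_two_adic_valuation_tiles_Z3 (k l : ℕ) (hk : 0 < k) (hl : 0 < l)
    (h : padicValNat 2 k = padicValNat 2 l) :
    TilesZd 3 (punctTile k 1 l) := by
  refine HasFlips.tilesZd hk hl ?_
  rcases lt_trichotomy k l with hkl | rfl | hkl
  · exact hasFlips_of_lt hkl
  · exact hasFlips_self hk
  · exact (hasFlips_of_lt hkl).symm
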